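/- Let f : X → X be a nonsingular map which is countable to one (mod 0) on a nonatomic Lebesgue probability space (X, 𝓑, μ). Then the following are equivalent: (1) f is measure-expansive; (2) f is eventually aperiodic; (3) f is aperiodic; (4) f has a strong generator. -/

import Mathlib

open MeasureTheory Set Function Filter
open scoped ENNReal

variable {X : Type*}

/-- A countable partition of a measure space: a countable disjoint collection of
nonempty measurable sets whose union is the whole space. -/
def IsCountablePartition [MeasurableSpace X] (P : Set (Set X)) : Prop :=
  P.Countable ∧ (∀ ξ ∈ P, MeasurableSet ξ) ∧ (∀ ξ ∈ P, ξ.Nonempty) ∧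
    P.PairwiseDisjoint id ∧ ⋃₀ P = Set.univ

/-- The set of points `y` having the same `P`-itinerary as `x` under `f`:
for every `n`, `f^n y` lies in the element of `P` containing `f^n x`. -/
def sameItinerary (f : X → X) (P : Set (Set X)) (x : X) : Set X :=
  {y | ∀ n : ℕ, ∃ ξ ∈ P, f^[n] x ∈ ξ ∧ f^[n] y ∈ ξ}

/-- A measure-sensitive partition for `f`: a countable partition such that for every `x`
the set of points with the same itinerary as `x` is `μ`-null. -/
def IsMeasureSensitivePartition [MeasurableSpace X] (μ : Measure X) (f : X → X)
    (P : Set (Set X)) : Prop :=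
  IsCountablePartition P ∧ ∀ x : X, μ (sameItinerary f P x) = 0

/-- A map is measure-expansive if it admits a measure-sensitive partition. -/
def MeasureExpansive [MeasurableSpace X] (μ : Measure X) (f : X → X) : Prop :=
  ∃ P : Set (Set X), IsMeasureSensitivePartition μ f P

/-- An atom of a measure: a measurable set of positive measure all of whose measurable
subsets have measure `0` or full measure of the set. -/
def IsMeasureAtom [MeasurableSpace X] (μ : Measure X) (A : Set X) : Prop :=
  MeasurableSet A ∧ 0 < μ A ∧ ∀ B : Set X, B ⊆ A → MeasurableSet B → μ B = 0 ∨ μ B = μ A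

/-- A measure is nonatomic if it has no atoms. -/
def Nonatomic [MeasurableSpace X] (μ : Measure X) : Prop :=
  ∀ A : Set X, ¬ IsMeasureAtom μ A

/-- A strong generator of `f`: a countable partition `P` such that the smallest σ-algebra
containing `⋃_{k∈ℕ} f^{-k}(P)` equals the full σ-algebra mod `μ`-null sets. -/
def IsStrongGenerator [MeasurableSpace X] (μ : Measure X) (f : X → X)
    (P : Set (Set X)) : Prop :=
  IsCountablePartition P ∧
    ∀ B : Set X, MeasurableSet B →
      ∃ A : Set X,
        MeasurableSet[MeasurableSpace.generateFrom
          {S : Set X | ∃ k : ℕ, ∃ ξ ∈ P, S = f^[k] ⁻¹' ξ}] A ∧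
        μ (symmDiff A B) = 0

/-- `f` is aperiodic: for every `n ≥ 1`, any measurable set on which `f^n x = x` is null. -/
def AperiodicMap [MeasurableSpace X] (μ : Measure X) (f : X → X) : Prop :=
  ∀ n : ℕ, 0 < n → ∀ A : Set X, MeasurableSet A → (∀ x ∈ A, f^[n] x = x) → μ A = 0

/-- `f` is eventually aperiodic: for every `n ≥ 1` and `k ∈ ℕ`, any measurable set `A` such
that each `x ∈ A` satisfies `f^{n+i} x = f^i x` for some `0 ≤ i ≤ k` is null. -/
def EventuallyAperiodicMap [MeasurableSpace X] (μ : Measure X) (f : X → X) : Prop :=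
  ∀ n k : ℕ, 0 < n → ∀ A : Set X, MeasurableSet A →
    (∀ x ∈ A, ∃ i ≤ k, f^[n + i] x = f^[i] x) → μ A = 0

/-- `(X, μ)` is point-isomorphic to the completion of the probability space `(Y, ν)` with `Y`
a standard Borel space. -/
def IsIsoToCompletion [MeasurableSpace X] (μ : Measure X)
    (Y : Type) [MeasurableSpace Y] (ν : Measure Y) : Prop :=
  StandardBorelSpace Y ∧ IsProbabilityMeasure ν ∧
    ∃ e : X ≃ᵐ NullMeasurableSpace Y ν, Measure.map (⇑e) μ = ν.completion

/-- A Lebesgue probability space: a complete probability space isomorphic to the completion of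
a standard probability space. -/
def IsLebesgueProbabilitySpace [MeasurableSpace X] (μ : Measure X) : Prop :=
  μ.IsComplete ∧ IsProbabilityMeasure μ ∧
    ∃ (Y : Type) (mY : MeasurableSpace Y) (ν : @Measure Y mY),
      @IsIsoToCompletion X _ μ Y mY ν

/-- A real coordinate on a Lebesgue space. -/
lemma exists_coord [MeasurableSpace X] (μ : Measure X) (hleb : IsLebesgueProbabilitySpace μ) :
    ∃ φ : X → ℝ, Measurable φ ∧ Injective φ ∧ ∀ B, MeasurableSet B →
      ∃ C, MeasurableSet C ∧ C ⊆ φ '' B ∧ μ (B \ φ ⁻¹' C) = 0 := by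
  obtain ⟨-, -, Y, mY, ν, hY, hν, e, he⟩ := hleb
  let em : Y → ℝ := embeddingReal Y
  have hem : MeasurableEmbedding em := measurableEmbedding_embeddingReal Y
  let i : NullMeasurableSpace Y ν → Y := fun y => y
  have hi : Measurable i := fun s hs => hs.nullMeasurableSet
  refine ⟨fun x => em (i (e x)), hem.measurable.comp (hi.comp e.measurable),
    fun x y h => e.injective (hem.injective h), fun B hB => ?_⟩
  have h1 : @NullMeasurableSet Y mY (e.symm ⁻¹' B) ν := e.symm.measurable hB
  obtain ⟨t, hts, ht, hte⟩ := h1.exists_measurable_subset_ae_eq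
  refine ⟨em '' t, hem.measurableSet_image.2 ht, ?_, ?_⟩
  · rintro _ ⟨y, hy, rfl⟩
    refine ⟨e.symm y, hts hy, ?_⟩
    exact congrArg (fun z : NullMeasurableSpace Y ν => em (i z)) (e.apply_symm_apply y)
  · let t' : Set (NullMeasurableSpace Y ν) := i ⁻¹' t
    have h2 : B \ (fun x => em (i (e x))) ⁻¹' (em '' t) = e ⁻¹' ((e.symm ⁻¹' B) \ t') := by
      ext x
      have : (em (i (e x)) ∈ em '' t) ↔ e x ∈ t' := hem.injective.mem_set_image
      simp [this]
    rw [h2, ← e.map_apply, he]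
    exact (ae_le_set.1 hte.symm.le)

/-- The markers: a vanishing sequence of sweeping sets. -/
lemma exists_markers [MeasurableSpace X] (μ : Measure X) (φ : X → ℝ) (hφ : Measurable φ)
    (hinj : Injective φ) (f : X → X) (hf : Measurable f)
    (horb : ∀ᵐ x ∂μ, Injective fun n : ℕ => f^[n] x) :
    ∃ E : ℕ → Set X, (∀ n, MeasurableSet (E n)) ∧ (∀ x, {n | x ∈ E n}.Finite) ∧
      ∀ᵐ x ∂μ, ∀ n, ∃ j, f^[j] x ∈ E n := by
  let ψ : X → ℝ := fun x => Real.arctan (φ x)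
  have hψ : Measurable ψ := Real.measurable_arctan.comp hφ
  have hψi : Injective ψ := Real.arctan_injective.comp hinj
  let L : X → ℝ := fun x => liminf (fun n => ψ (f^[n] x)) atTop
  have hL : Measurable L := Measurable.liminf fun n => hψ.comp (hf.iterate n)
  have hLj : ∀ j x, L (f^[j] x) = L x := by
    intro j x
    have := Filter.liminf_nat_add (fun n => ψ (f^[n] x)) j
    simp only [Function.iterate_add_apply] at this
    exact this
  refine ⟨fun n => {x | ψ x ≠ L x ∧ |ψ x - L x| < 1 / ((n : ℝ) + 1)}, fun n => ?_, fun x => ?_, ?_⟩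
  · exact (measurableSet_eq_fun hψ hL).compl.inter
      (measurableSet_lt (hψ.sub hL).abs measurable_const)
  · by_cases h : ψ x = L x
    · simp [h]
    · have hpos : 0 < |ψ x - L x| := abs_pos.2 (sub_ne_zero.2 h)
      obtain ⟨N, hN⟩ := exists_nat_one_div_lt hpos
      refine (Set.finite_lt_nat N).subset ?_
      rintro n ⟨-, hn⟩
      by_contra hlt
      have : N ≤ n := not_lt.1 hlt
      have := Nat.one_div_le_one_div (α := ℝ) this
      linarith
  · filter_upwards [horb] with x hx n
    have hε : (0 : ℝ) < 1 / ((n : ℝ) + 1) := by positivity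
    set ε := 1 / ((n : ℝ) + 1)
    have hb1 : ∀ m, -2 ≤ ψ (f^[m] x) := fun m => by
      have := Real.neg_pi_div_two_lt_arctan (φ (f^[m] x)); have := Real.pi_le_four
      show -2 ≤ Real.arctan _
      linarith
    have hb2 : ∀ m, ψ (f^[m] x) ≤ 2 := fun m => by
      have := Real.arctan_lt_pi_div_two (φ (f^[m] x)); have := Real.pi_le_four
      show Real.arctan _ ≤ 2
      linarith
    have B1 : IsBoundedUnder (· ≥ ·) atTop (fun n => ψ (f^[n] x)) :=
      isBoundedUnder_of ⟨-2, hb1⟩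
    have B2 : IsBoundedUnder (· ≤ ·) atTop (fun n => ψ (f^[n] x)) :=
      isBoundedUnder_of ⟨2, hb2⟩
    have e1 : ∀ᶠ m in atTop, L x - ε < ψ (f^[m] x) :=
      eventually_lt_of_lt_liminf (sub_lt_self _ hε) B1
    have e2 : ∃ᶠ m in atTop, ψ (f^[m] x) < L x + ε :=
      frequently_lt_of_liminf_lt B2.isCoboundedUnder_ge (lt_add_of_pos_right _ hε)
    have e3 : ∀ᶠ m in atTop, ψ (f^[m] x) ≠ L x := by
      by_cases h : ∃ m, ψ (f^[m] x) = L x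
      · obtain ⟨m, hm⟩ := h
        filter_upwards [eventually_gt_atTop m] with k hk hkk
        exact hk.ne' (hx (hψi (hkk.trans hm.symm)))
      · push Not at h
        exact Eventually.of_forall h
    obtain ⟨m, h1, h2, h3⟩ := (e2.and_eventually (e1.and e3)).exists
    refine ⟨m, ?_⟩
    simp only [hLj]
    exact ⟨h3, abs_lt.2 ⟨by linarith, by linarith⟩⟩

/-- Relative countable generation: `𝓑` is generated mod 0 by `f⁻¹ 𝓑` and a countable partition. -/
lemma exists_index [MeasurableSpace X] (μ : Measure X) [IsProbabilityMeasure μ]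
    (φ : X → ℝ) (hφ : Measurable φ)
    (hinj : Injective φ) (hC : ∀ B, MeasurableSet B →
      ∃ C, MeasurableSet C ∧ C ⊆ φ '' B ∧ μ (B \ φ ⁻¹' C) = 0)
    (f : X → X) (hq : Measure.QuasiMeasurePreserving f μ μ)
    (hcto : ∀ᵐ x ∂μ, (f ⁻¹' {x}).Countable) :
    ∃ ι : X → ℕ, Measurable ι ∧ ∀ D, MeasurableSet D → ∃ T : ℕ → Set X,
      (∀ n, MeasurableSet (T n)) ∧ ∀ᵐ x ∂μ, (x ∈ D ↔ f x ∈ T (ι x)) := by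
  have hf := hq.measurable
  -- Borel approximations
  have hC' : ∀ B, MeasurableSet B → ∃ C, MeasurableSet C ∧ C ⊆ φ '' B ∧
      ∀ᵐ x ∂μ, (φ x ∈ C ↔ x ∈ B) := by
    intro B hB
    obtain ⟨C, h1, h2, h3⟩ := hC B hB
    refine ⟨C, h1, h2, ?_⟩
    filter_upwards [measure_eq_zero_iff_ae_notMem.1 h3] with x hx
    constructor
    · intro h
      obtain ⟨y, hy, hxy⟩ := h2 h
      rwa [← hinj hxy]
    · intro h
      by_contra h'
      exact hx ⟨h, h'⟩
  let ρ : Measure (X × ℝ) := μ.map (fun x => (f x, φ x))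
  have hm : Measurable (fun x => (f x, φ x)) := hf.prodMk hφ
  have : IsProbabilityMeasure ρ := Measure.isProbabilityMeasure_map hm.aemeasurable
  let κ := ρ.condKernel
  have hρ : Measure.compProd ρ.fst κ = ρ := ρ.disintegrate κ
  have hfst : ρ.fst = μ.map f := Measure.fst_map_prodMk hφ
  -- the graph
  have hU : ∀ q : ℚ, MeasurableSet {x | φ (f x) < q} := fun q =>
    measurableSet_lt (hφ.comp hf) measurable_const
  choose C hCm hCs hCae using fun q : ℚ => hC' _ (hU q)
  have hX0 : MeasurableSet {x | ∀ q : ℚ, φ x ∈ C q ↔ φ (f x) < q} := by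
    simp only [ofPred_forall]
    refine MeasurableSet.iInter fun q => ?_
    exact MeasurableSet.iff (hφ (hCm q)) (hU q)
  obtain ⟨R, hRm, hRs, hRae⟩ := hC' _ hX0
  have hX0ae : ∀ᵐ x ∂μ, ∀ q : ℚ, φ x ∈ C q ↔ φ (f x) < q := ae_all_iff.2 hCae
  let Γ : Set (X × ℝ) := {p | p.2 ∈ R ∧ ∀ q : ℚ, p.2 ∈ C q ↔ φ p.1 < q}
  have hΓ : MeasurableSet Γ := by
    have : Γ = Prod.snd ⁻¹' R ∩ ⋂ q : ℚ, {p | p.2 ∈ C q ↔ φ p.1 < q} := by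
      ext p; simp [Γ]
    rw [this]
    refine (measurable_snd hRm).inter ?_
    refine MeasurableSet.iInter fun q => ?_
    exact MeasurableSet.iff (measurable_snd (hCm q))
      (measurableSet_lt (hφ.comp measurable_fst) measurable_const)
  have hρΓ : ∀ᵐ p ∂ρ, p ∈ Γ := by
    refine (ae_map_iff hm.aemeasurable hΓ).2 ?_
    filter_upwards [hX0ae, hRae] with x h1 h2
    exact ⟨h2.2 h1, h1⟩
  have hΓy : ∀ y, {r | (y, r) ∈ Γ} ⊆ φ '' (f ⁻¹' {y}) := by
    rintro y r ⟨hr, hr2⟩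
    obtain ⟨x, hx, rfl⟩ := hRs hr
    refine ⟨x, hinj ?_, rfl⟩
    have : ∀ q : ℚ, φ (f x) < q ↔ φ y < q := fun q => (hx q).symm.trans (hr2 q)
    by_contra hne
    rcases lt_or_gt_of_ne hne with h | h
    · obtain ⟨q, h1, h2⟩ := exists_rat_btwn h
      exact absurd ((this q).1 h1) (not_lt.2 h2.le)
    · obtain ⟨q, h1, h2⟩ := exists_rat_btwn h
      exact absurd ((this q).2 h1) (not_lt.2 h2.le)
  have hcto' : ∀ᵐ y ∂ρ.fst, (f ⁻¹' {y}).Countable := by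
    rw [hfst]; exact hq.absolutelyContinuous.ae_le hcto
  -- mass of single points
  have hgm : Measurable fun p : X × ℝ => κ p.1 {p.2} := by
    have := ProbabilityTheory.Kernel.measurable_kernel_prodMk_left
      (κ := ProbabilityTheory.Kernel.comap κ (Prod.fst : X × ℝ → X) measurable_fst)
      (t := {p : (X × ℝ) × ℝ | p.2 = p.1.2})
      (measurableSet_eq_fun (by fun_prop) (by fun_prop))
    exact this
  have hpos : ∀ᵐ x ∂μ, κ (f x) {φ x} ≠ 0 := by
    have hms : MeasurableSet {p : X × ℝ | κ p.1 {p.2} ≠ 0} :=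
      (hgm (measurableSet_singleton 0)).compl
    refine (ae_map_iff hm.aemeasurable hms).1 ?_
    show ∀ᵐ p ∂ρ, κ p.1 {p.2} ≠ 0
    rw [← hρ] at hρΓ ⊢
    refine (Measure.ae_compProd_iff hms).2 ?_
    filter_upwards [hcto', Measure.ae_ae_of_ae_compProd hρΓ] with y h1 h2
    have h3 : {r | (y, r) ∈ Γ}.Countable := (h1.image φ).mono (hΓy y)
    have h4 : κ y ({r | (y, r) ∈ Γ} ∩ {r | κ y {r} = 0}) = 0 := by
      have h5 : ({r | (y, r) ∈ Γ} ∩ {r | κ y {r} = 0}).Countable := h3.mono inter_subset_left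
      rw [← biUnion_of_singleton ({r | (y, r) ∈ Γ} ∩ {r | κ y {r} = 0})]
      exact (measure_biUnion_null_iff h5).2 fun r hr => hr.2
    filter_upwards [h2, measure_eq_zero_iff_ae_notMem.1 h4] with r h5 h6 h7
    exact h6 ⟨h5, h7⟩
  -- the injectivity pieces
  obtain ⟨I, hI⟩ := (TopologicalSpace.countable_countableBasis ℝ).exists_eq_range
    (by
      obtain ⟨V, hV, -⟩ := (TopologicalSpace.isBasis_countableBasis ℝ).exists_subset_of_mem_open
        (mem_univ (0 : ℝ)) isOpen_univ
      exact ⟨V, hV⟩)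
  have hbas := TopologicalSpace.isBasis_countableBasis ℝ
  have hIo : ∀ n, IsOpen (I n) := fun n => hbas.isOpen (hI ▸ mem_range_self n)
  let S : ℕ → Set X := fun n => {x | φ x ∈ I n ∧ κ (f x) (I n) < 2 * κ (f x) {φ x}}
  have hS : ∀ n, MeasurableSet (S n) := by
    intro n
    have : S n = φ ⁻¹' (I n) ∩ {x | κ (f x) (I n) < 2 * κ (f x) {φ x}} := by
      ext x; simp [S]
    rw [this]
    refine (hφ (hIo n).measurableSet).inter (measurableSet_lt ?_ ?_)
    · exact (κ.measurable_coe (hIo n).measurableSet).comp hf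
    · exact (hgm.comp hm).const_mul 2
  have hcov : ∀ᵐ x ∂μ, ∃ n, x ∈ S n := by
    filter_upwards [hpos] with x hx
    have h1 : κ (f x) {φ x} < 2 * κ (f x) {φ x} := by
      rw [two_mul]
      exact ENNReal.lt_add_right (measure_ne_top _ _) hx
    obtain ⟨U, hU1, hU2, hU3⟩ := Set.exists_isOpen_lt_of_lt _ _ h1
    obtain ⟨V, hV, hxV, hVU⟩ := hbas.exists_subset_of_mem_open (hU1 rfl) hU2
    rw [hI] at hV
    obtain ⟨n, rfl⟩ := hV
    exact ⟨n, hxV, (measure_mono hVU).trans_lt hU3⟩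
  classical
  let ι : X → ℕ := fun x => if h : ∃ n, x ∈ S n then Nat.find h else 0
  have hι : Measurable ι := by
    refine measurable_to_countable' fun n => ?_
    have : ι ⁻¹' {n} = (S n ∩ ⋂ m ∈ Set.Iio n, (S m)ᶜ) ∪
        ({x | n = 0} ∩ ⋂ m, (S m)ᶜ) := by
      ext x
      by_cases h : ∃ n, x ∈ S n
      · have h' : ¬ ∀ i, x ∉ S i := by push Not; exact h
        simp [ι, h, h', Nat.find_eq_iff]
      · have h' : ∀ i, x ∉ S i := by push Not at h; exact h
        simp [ι, h', eq_comm]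
    rw [this]
    refine MeasurableSet.union ((hS n).inter ?_) ((MeasurableSet.const _).inter ?_)
    · exact MeasurableSet.biInter (Set.to_countable _) fun m _ => (hS m).compl
    · exact MeasurableSet.iInter fun m => (hS m).compl
  have hιS : ∀ᵐ x ∂μ, x ∈ S (ι x) := by
    filter_upwards [hcov] with x hx
    simp only [ι, hx, dite_true]
    exact Nat.find_spec hx
  refine ⟨ι, hι, fun D hD => ?_⟩
  obtain ⟨K, hKm, -, hKae⟩ := hC' D hD
  refine ⟨fun n => {y | κ y (I n) < 2 * κ y (K ∩ I n)}, fun n => ?_, ?_⟩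
  · exact measurableSet_lt (κ.measurable_coe (hIo n).measurableSet)
      ((κ.measurable_coe (hKm.inter (hIo n).measurableSet)).const_mul 2)
  · filter_upwards [hKae, hιS] with x h1 h2
    rw [← h1]
    generalize ι x = n at h2
    obtain ⟨h3, h4⟩ := h2
    constructor
    · intro hx
      refine h4.trans_le ?_
      gcongr
      exact singleton_subset_iff.2 ⟨hx, h3⟩
    · intro hx
      by_contra hxK
      have hx' : κ (f x) (I n) < 2 * κ (f x) (K ∩ I n) := hx
      have hdis : Disjoint (K ∩ I n) {φ x} := by
        rw [Set.disjoint_singleton_right]; exact fun h => hxK h.1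
      have hsum : κ (f x) (K ∩ I n) + κ (f x) {φ x} ≤ κ (f x) (I n) := by
        rw [← measure_union hdis (measurableSet_singleton _)]
        exact measure_mono (union_subset inter_subset_right (singleton_subset_iff.2 h3))
      have := ENNReal.add_lt_add hx' h4
      rw [← mul_add, ← two_mul] at this
      have h5 : 2 * (κ (f x) (K ∩ I n) + κ (f x) {φ x}) ≤ 2 * κ (f x) (I n) := by gcongr
      exact absurd this (not_lt.2 h5)

/-- The `ι`-itinerary of length `j`. -/
def itin (ι : X → ℕ) (f : X → X) : ℕ → X → List ℕ
  | 0, _ => []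
  | j + 1, x => ι x :: itin ι f j (f x)

lemma itin_length (ι : X → ℕ) (f : X → X) (j : ℕ) (x : X) : (itin ι f j x).length = j := by
  induction j generalizing x with
  | zero => rfl
  | succ j ih => simp [itin, ih]

lemma itin_meas (ι : X → ℕ) (f : X → X) (m : MeasurableSpace X)
    (h : ∀ i n, MeasurableSet[m] {x | ι (f^[i] x) = n}) (j : ℕ) (w : List ℕ) (i : ℕ) :
    MeasurableSet[m] {x | itin ι f j (f^[i] x) = w} := by
  induction j generalizing w i with
  | zero =>
    by_cases hw : [] = w
    · simp [itin, hw]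
    · simp [itin, hw]
  | succ j ih =>
    cases w with
    | nil => simp [itin]
    | cons n w =>
      have : {x | itin ι f (j + 1) (f^[i] x) = n :: w} =
          {x | ι (f^[i] x) = n} ∩ {x | itin ι f j (f^[i + 1] x) = w} := by
        ext x
        simp [itin, Function.iterate_succ_apply']
      rw [this]
      exact (h i n).inter (ih w (i + 1))

lemma itin_step [MeasurableSpace X] (μ : Measure X) (f : X → X)
    (hq : Measure.QuasiMeasurePreserving f μ μ) (ι : X → ℕ)
    (hι : ∀ D, MeasurableSet D → ∃ T : ℕ → Set X,
      (∀ n, MeasurableSet (T n)) ∧ ∀ᵐ x ∂μ, (x ∈ D ↔ f x ∈ T (ι x)))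
    (j : ℕ) (D : Set X) (hD : MeasurableSet D) :
    ∃ T : List ℕ → Set X, (∀ w, MeasurableSet (T w)) ∧
      ∀ᵐ x ∂μ, (x ∈ D ↔ f^[j] x ∈ T (itin ι f j x)) := by
  induction j generalizing D with
  | zero => exact ⟨fun _ => D, fun _ => hD, by simp⟩
  | succ j ih =>
    obtain ⟨T1, hT1, h1⟩ := hι D hD
    choose T2 hT2 h2 using fun n => ih (T1 n) (hT1 n)
    refine ⟨fun w => match w with
      | [] => ∅
      | n :: w => T2 n w, fun w => ?_, ?_⟩
    · cases w with
      | nil => exact MeasurableSet.empty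
      | cons n w => exact hT2 n w
    · filter_upwards [h1, hq.ae (ae_all_iff.2 h2)] with x h3 h4
      rw [h3, h4 (ι x)]
      simp [itin]

/-- Countable partition encoding a point-finite countable family of sets. -/
lemma exists_partition [MeasurableSpace X] (f : X → X) {J : Type*} [Countable J]
    (V : J → Set X) (hV : ∀ i, MeasurableSet (V i)) (hfin : ∀ x, {i | x ∈ V i}.Finite) :
    ∃ P : Set (Set X), IsCountablePartition P ∧ ∀ k i,
      MeasurableSet[MeasurableSpace.generateFrom
          {S : Set X | ∃ k : ℕ, ∃ ξ ∈ P, S = f^[k] ⁻¹' ξ}] (f^[k] ⁻¹' (V i)) := by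
  classical
  let l : X → Finset J := fun x => (hfin x).toFinset
  have hl : ∀ x i, i ∈ l x ↔ x ∈ V i := fun x i => by simp [l]
  refine ⟨(fun s => l ⁻¹' {s}) '' range l, ⟨?_, ?_, ?_, ?_, ?_⟩, ?_⟩
  · exact (Set.to_countable _).image _
  · rintro _ ⟨s, -, rfl⟩
    have : l ⁻¹' {s} = ⋂ i, {x | i ∈ s ↔ x ∈ V i} := by
      ext x
      simp only [mem_preimage, mem_singleton_iff, mem_iInter, Finset.ext_iff, hl]
      exact forall_congr' fun i => iff_comm
    simp only [this]
    exact MeasurableSet.iInter fun i => MeasurableSet.iff (MeasurableSet.const _) (hV i)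
  · rintro _ ⟨_, ⟨x, rfl⟩, rfl⟩
    exact ⟨x, rfl⟩
  · rintro _ ⟨s, -, rfl⟩ _ ⟨t, -, rfl⟩ hst
    refine Set.disjoint_left.2 fun x hx hy => hst ?_
    have h1 : l x = s := hx
    have h2 : l x = t := hy
    rw [← h1, ← h2]
  · refine eq_univ_of_forall fun x => ?_
    exact ⟨l ⁻¹' {l x}, ⟨l x, ⟨x, rfl⟩, rfl⟩, rfl⟩
  · intro k i
    have : f^[k] ⁻¹' (V i) = ⋃ s ∈ {s | s ∈ range l ∧ i ∈ s}, f^[k] ⁻¹' (l ⁻¹' {s}) := by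
      ext x
      simp [← hl]
    rw [this]
    refine MeasurableSet.biUnion (Set.to_countable _) fun s hs => ?_
    exact MeasurableSpace.measurableSet_generateFrom ⟨k, _, ⟨s, hs.1, rfl⟩, rfl⟩

lemma exists_generator [MeasurableSpace X] (μ : Measure X) [IsProbabilityMeasure μ]
    (φ : X → ℝ) (hφ : Measurable φ)
    (hinj : Injective φ) (hC : ∀ B, MeasurableSet B →
      ∃ C, MeasurableSet C ∧ C ⊆ φ '' B ∧ μ (B \ φ ⁻¹' C) = 0)
    (f : X → X) (hq : Measure.QuasiMeasurePreserving f μ μ)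
    (hcto : ∀ᵐ x ∂μ, (f ⁻¹' {x}).Countable)
    (horb : ∀ᵐ x ∂μ, Injective fun n : ℕ => f^[n] x) :
    ∃ P : Set (Set X), IsStrongGenerator μ f P := by
  have hf := hq.measurable
  obtain ⟨E, hE, hEfin, hEsw⟩ := exists_markers μ φ hφ hinj f hf horb
  obtain ⟨ι, hιm, hι⟩ := exists_index μ φ hφ hinj hC f hq hcto
  let D : ℚ → Set X := fun q => {x | φ x < q}
  have hD : ∀ q, MeasurableSet (D q) := fun q => measurableSet_lt hφ measurable_const
  choose T hT hTae using fun (q : ℚ) (j : ℕ) => itin_step μ f hq ι hι j (D q) (hD q)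
  let Z : ℚ × ℕ → List ℕ → Set X := fun k w =>
    {x | itin ι f w.length x = w} ∩ f^[w.length] ⁻¹' (E (Encodable.encode k))
  have hZ : ∀ k w, MeasurableSet (Z k w) := fun k w =>
    (itin_meas ι f _ (fun i n => (hιm.comp (hf.iterate i)) (measurableSet_singleton n))
      w.length w 0).inter ((hf.iterate _) (hE _))
  have hN : ∀ k : ℚ × ℕ, ∃ N : ℕ,
      μ {x | ∀ w, Encodable.encode w < N → x ∉ Z k w} < ((k.2 : ℝ≥0∞) + 1)⁻¹ := by
    intro k
    let s : ℕ → Set X := fun N => {x | ∀ w, Encodable.encode w < N → x ∉ Z k w}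
    have hs : ∀ N, MeasurableSet (s N) := by
      intro N
      have : s N = ⋂ w : List ℕ, ⋂ _ : Encodable.encode w < N, (Z k w)ᶜ := by
        ext x; simp [s]
      rw [this]
      exact MeasurableSet.iInter fun w => MeasurableSet.iInter fun _ => (hZ k w).compl
    have hanti : Antitone s := fun a b hab x hx w hw => hx w (hw.trans_le hab)
    have ht := tendsto_measure_iInter_atTop (μ := μ) (fun N => (hs N).nullMeasurableSet) hanti
      ⟨0, measure_ne_top _ _⟩
    have h0 : μ (⋂ N, s N) = 0 := by
      refine measure_eq_zero_iff_ae_notMem.2 ?_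
      filter_upwards [hEsw] with x hx hxs
      obtain ⟨j, hj⟩ := hx (Encodable.encode k)
      have := mem_iInter.1 hxs (Encodable.encode (itin ι f j x) + 1) (itin ι f j x)
        (Nat.lt_succ_self _)
      apply this
      refine ⟨?_, ?_⟩
      · simp [itin_length]
      · simpa [itin_length] using hj
    rw [h0] at ht
    have hpos : (0 : ℝ≥0∞) < ((k.2 : ℝ≥0∞) + 1)⁻¹ :=
      ENNReal.inv_pos.2 (ENNReal.add_ne_top.2 ⟨ENNReal.natCast_ne_top _, ENNReal.one_ne_top⟩)
    exact (ht.eventually (gt_mem_nhds hpos)).exists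
  choose N hN using hN
  let V : ℕ ⊕ (Σ _ : ℚ × ℕ, List ℕ) → Set X := fun i => match i with
    | Sum.inl n => {x | ι x = n}
    | Sum.inr p => {x | Encodable.encode p.2 < N p.1} ∩
        (E (Encodable.encode p.1) ∩ T p.1.1 p.2.length p.2)
  have hV : ∀ i, MeasurableSet (V i) := by
    rintro (n | p)
    · exact hιm (measurableSet_singleton n)
    · exact (MeasurableSet.const _).inter ((hE _).inter (hT _ _ _))
  have hVfin : ∀ x, {i | x ∈ V i}.Finite := by
    intro x
    have h1 : {k : ℚ × ℕ | x ∈ E (Encodable.encode k)}.Finite :=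
      (hEfin x).preimage Encodable.encode_injective.injOn
    have h2 : ∀ k, {w : List ℕ | Encodable.encode w < N k}.Finite := fun k =>
      (Set.finite_lt_nat (N k)).preimage Encodable.encode_injective.injOn
    refine (((Set.finite_singleton (ι x)).image Sum.inl).union
      (h1.biUnion fun k _ => (h2 k).image fun w =>
        (Sum.inr ⟨k, w⟩ : ℕ ⊕ (Σ _ : ℚ × ℕ, List ℕ)))).subset ?_
    rintro (n | p) hi
    · left
      have : ι x = n := hi
      simp [this]
    · right
      exact mem_iUnion₂.2 ⟨p.1, hi.2.1, p.2, hi.1, rfl⟩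
  obtain ⟨P, hP, hPm⟩ := exists_partition f V hV hVfin
  refine ⟨P, hP, ?_⟩
  set G := MeasurableSpace.generateFrom {S : Set X | ∃ k : ℕ, ∃ ξ ∈ P, S = f^[k] ⁻¹' ξ}
  let A : ℚ × ℕ → Set X := fun k => ⋃ w ∈ {w : List ℕ | Encodable.encode w < N k},
    {x | itin ι f w.length x = w} ∩ f^[w.length] ⁻¹' (V (Sum.inr ⟨k, w⟩))
  have hA : ∀ k, MeasurableSet[G] (A k) := by
    intro k
    refine @MeasurableSet.biUnion _ _ G _ _ (Set.to_countable _) fun w _ => ?_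
    refine @MeasurableSet.inter _ G _ _ ?_ (hPm w.length (Sum.inr ⟨k, w⟩))
    exact itin_meas ι f G (fun i n => hPm i (Sum.inl n)) w.length w 0
  have hTae' : ∀ᵐ x ∂μ, ∀ q j, (x ∈ D q ↔ f^[j] x ∈ T q j (itin ι f j x)) :=
    ae_all_iff.2 fun q => ae_all_iff.2 fun j => hTae q j
  have hAD : ∀ᵐ x ∂μ, ∀ k : ℚ × ℕ, x ∈ A k → x ∈ D k.1 := by
    filter_upwards [hTae'] with x hx k hxA
    obtain ⟨w, hw, h1, h2⟩ := mem_iUnion₂.1 hxA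
    have h1' : itin ι f w.length x = w := h1
    rw [hx k.1 w.length, h1']
    exact h2.2.2
  have hDA : ∀ᵐ x ∂μ, ∀ k : ℚ × ℕ, x ∈ D k.1 → x ∉ A k →
      x ∈ {x | ∀ w, Encodable.encode w < N k → x ∉ Z k w} := by
    filter_upwards [hTae'] with x hx k hxD hxA w hw hZw
    apply hxA
    have h1' : itin ι f w.length x = w := hZw.1
    have := (hx k.1 w.length).1 hxD
    rw [h1'] at this
    exact mem_iUnion₂.2 ⟨w, hw, hZw.1, hw, hZw.2, this⟩
  have hDG : ∀ q, MeasurableSet[eventuallyMeasurableSpace G (ae μ)] (D q) := by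
    intro q
    refine ⟨⋃ n, A (q, n), MeasurableSet.iUnion fun n => hA (q, n), ?_⟩
    have h1 : μ (D q \ ⋃ n, A (q, n)) = 0 := by
      refine le_antisymm (ENNReal.le_of_forall_pos_le_add ?_) zero_le
      intro ε hε _
      obtain ⟨n, hn⟩ := ENNReal.exists_inv_nat_lt (a := (ε : ℝ≥0∞)) (by simpa using hε.ne')
      have h2 : μ (D q \ ⋃ n, A (q, n)) ≤
          μ {x | ∀ w, Encodable.encode w < N (q, n) → x ∉ Z (q, n) w} := by
        refine measure_mono_ae ?_
        filter_upwards [hDA] with x hx hx2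
        exact hx (q, n) hx2.1 fun h => hx2.2 (mem_iUnion.2 ⟨n, h⟩)
      rw [zero_add]
      refine h2.trans ((hN (q, n)).le.trans (le_trans ?_ hn.le))
      simp only
      gcongr
      exact le_self_add
    filter_upwards [hAD, measure_eq_zero_iff_ae_notMem.1 h1] with x h2 h3
    refine propext ⟨fun h => ?_, fun h => ?_⟩
    · by_contra h'
      exact h3 ⟨h, h'⟩
    · obtain ⟨n, hn⟩ := mem_iUnion.1 h
      exact h2 (q, n) hn
  have hφG : Measurable[eventuallyMeasurableSpace G (ae μ)] φ := by
    rw [BorelSpace.measurable_eq (α := ℝ), Real.borel_eq_generateFrom_Iio_rat]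
    refine @measurable_generateFrom _ _ (eventuallyMeasurableSpace G (ae μ)) _ _ ?_
    intro t ht
    simp only [mem_iUnion, mem_singleton_iff] at ht
    obtain ⟨q, rfl⟩ := ht
    exact hDG q
  intro B hB
  obtain ⟨C, hCm, hCs, hC0⟩ := hC B hB
  obtain ⟨t, ht, hte⟩ := hφG hCm
  refine ⟨t, ht, measure_symmDiff_eq_zero_iff.2 (hte.symm.trans ?_)⟩
  filter_upwards [measure_eq_zero_iff_ae_notMem.1 hC0] with x hx
  refine propext ⟨fun h => ?_, fun h => ?_⟩
  · obtain ⟨y, hy, hxy⟩ := hCs h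
    show x ∈ B
    rwa [← hinj hxy]
  · by_contra h'
    exact hx ⟨h, h'⟩

lemma generator_imp_expansive [MeasurableSpace X] (μ : Measure X) [IsProbabilityMeasure μ]
    (hna : Nonatomic μ) (f : X → X) (hf : Measurable f) (P : Set (Set X))
    (hP : IsStrongGenerator μ f P) : MeasureExpansive μ f := by
  obtain ⟨⟨hPc, hPm, hPn, hPd, hPu⟩, hgen⟩ := hP
  refine ⟨P, ⟨hPc, hPm, hPn, hPd, hPu⟩, fun x => ?_⟩
  have huniq : ∀ ξ ∈ P, ∀ η ∈ P, ∀ z, z ∈ ξ → z ∈ η → ξ = η := fun ξ h1 η h2 z h3 h4 => by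
    by_contra hne
    exact Set.disjoint_left.1 (hPd h1 h2 hne) h3 h4
  by_contra hne
  have hm : MeasurableSet (sameItinerary f P x) := by
    have : sameItinerary f P x = ⋂ n : ℕ, ⋃ ξ ∈ P, {y | f^[n] x ∈ ξ} ∩ f^[n] ⁻¹' ξ := by
      ext y; simp [sameItinerary, and_left_comm]
    rw [this]
    exact MeasurableSet.iInter fun n => MeasurableSet.biUnion hPc fun ξ hξ =>
      (MeasurableSet.const _).inter ((hf.iterate n) (hPm ξ hξ))
  refine hna _ ⟨hm, pos_iff_ne_zero.2 hne, fun B hBC hB => ?_⟩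
  obtain ⟨A, hA, hAB⟩ := hgen B hB
  have hsat : sameItinerary f P x ⊆ A ∨ sameItinerary f P x ⊆ Aᶜ := by
    clear hAB
    induction A, hA using MeasurableSpace.generateFrom_induction with
    | hC t ht _ =>
      obtain ⟨k, ξ, hξ, rfl⟩ := ht
      by_cases hx : f^[k] x ∈ ξ
      · left
        intro y hy
        obtain ⟨η, hη, h1, h2⟩ := hy k
        rw [mem_preimage, huniq ξ hξ η hη _ hx h1]
        exact h2
      · right
        intro y hy hyξ
        obtain ⟨η, hη, h1, h2⟩ := hy k
        rw [huniq ξ hξ η hη _ hyξ h2] at hx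
        exact hx h1
    | empty => right; simp
    | compl t _ ih => rw [compl_compl]; exact ih.symm
    | iUnion s _ ih =>
      by_cases h : ∃ n, sameItinerary f P x ⊆ s n
      · obtain ⟨n, hn⟩ := h
        exact Or.inl (hn.trans (subset_iUnion s n))
      · right
        push Not at h
        rw [compl_iUnion]
        exact subset_iInter fun n => (ih n).resolve_left (h n)
  rw [measure_symmDiff_eq_zero_iff] at hAB
  rcases hsat with h | h
  · right
    refine le_antisymm (measure_mono hBC) ?_
    rw [← measure_congr hAB]
    exact measure_mono h
  · left
    rw [measure_eq_zero_iff_ae_notMem]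
    filter_upwards [hAB.mem_iff] with y hy hyB
    exact h (hBC hyB) (hy.2 hyB)

lemma expansive_imp_evAper [MeasurableSpace X] (μ : Measure X) (f : X → X)
    (h : MeasureExpansive μ f) : EventuallyAperiodicMap μ f := by
  obtain ⟨P, ⟨hPc, hPm, hPn, hPd, hPu⟩, hP⟩ := h
  intro n k hn A _ hA
  have hA' : ∀ x ∈ A, ∀ m, k ≤ m → f^[n + m] x = f^[m] x := by
    intro x hx m hm
    obtain ⟨i, hi, hix⟩ := hA x hx
    obtain ⟨d, rfl⟩ := Nat.exists_eq_add_of_le (hi.trans hm)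
    rw [show n + (i + d) = d + (n + i) by omega, show i + d = d + i by omega,
      Function.iterate_add_apply, hix, ← Function.iterate_add_apply]
  have hex : ∀ x, ∃ ξ : P, x ∈ ξ.1 := by
    intro x
    have : x ∈ ⋃₀ P := hPu ▸ mem_univ x
    obtain ⟨ξ, hξ, hx⟩ := this
    exact ⟨⟨ξ, hξ⟩, hx⟩
  choose p hp using hex
  have := hPc.to_subtype
  -- countably many codes
  let c : X → (Fin (n + k) → P) := fun x i => p (f^[i] x)
  have hsame : ∀ x ∈ A, ∀ y ∈ A, c x = c y → y ∈ sameItinerary f P x := by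
    intro x hx y hy hxy m
    have : p (f^[m] x) = p (f^[m] y) := by
      induction m using Nat.strong_induction_on with
      | _ m ih =>
        by_cases hm : m < n + k
        · exact congrFun hxy ⟨m, hm⟩
        · obtain ⟨d, rfl⟩ := Nat.exists_eq_add_of_le (not_lt.1 hm)
          rw [show n + k + d = n + (k + d) by omega, hA' x hx _ (by omega), hA' y hy _ (by omega)]
          exact ih _ (by omega)
    exact ⟨_, (p (f^[m] x)).2, hp _, this ▸ hp (f^[m] y)⟩
  have hsub : A ⊆ ⋃ s : Fin (n + k) → P, A ∩ c ⁻¹' {s} := fun x hx =>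
    mem_iUnion.2 ⟨c x, hx, rfl⟩
  refine measure_mono_null hsub (measure_iUnion_null fun s => ?_)
  rcases (A ∩ c ⁻¹' {s}).eq_empty_or_nonempty with h | ⟨x, hx, hxs⟩
  · rw [h]; exact measure_empty
  · refine measure_mono_null (fun y hy => ?_) (hP x)
    exact hsame x hx y hy.1 ((show c x = s from hxs).trans (show c y = s from hy.2).symm)

/-- For a nonsingular countable-to-one (mod 0) measurable map of a nonatomic
Lebesgue probability space, the following are equivalent: (1) measure-expansive;
(2) eventually aperiodic; (3) aperiodic; (4) has a strong generator. -/
theorem measureExpansive_tfae_lebesgue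
    [MeasurableSpace X] (μ : Measure X)
    (hleb : IsLebesgueProbabilitySpace μ) (hna : Nonatomic μ)
    (f : X → X) (hf : Measurable f)
    (hns : ∀ A : Set X, MeasurableSet A → (μ A = 0 ↔ μ (f ⁻¹' A) = 0))
    (hcto : ∀ᵐ x ∂μ, (f ⁻¹' {x}).Countable) :
    List.TFAE [MeasureExpansive μ f,
      EventuallyAperiodicMap μ f,
      AperiodicMap μ f,
      ∃ P : Set (Set X), IsStrongGenerator μ f P] := by
  have hprob : IsProbabilityMeasure μ := hleb.2.1
  have hq : Measure.QuasiMeasurePreserving f μ μ := by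
    refine ⟨hf, Measure.AbsolutelyContinuous.mk fun s hs h => ?_⟩
    rw [Measure.map_apply hf hs]
    exact (hns s hs).1 h
  tfae_have 1 → 2 := expansive_imp_evAper μ f
  tfae_have 2 → 3 := fun h n hn A hA hAx =>
    h n 0 hn A hA fun x hx => ⟨0, le_rfl, hAx x hx⟩
  tfae_have 4 → 1 := fun ⟨P, hP⟩ => generator_imp_expansive μ hna f hf P hP
  tfae_have 3 → 4 := by
    intro hap
    obtain ⟨φ, hφ, hinj, hC⟩ := exists_coord μ hleb
    refine exists_generator μ φ hφ hinj hC f hq hcto ?_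
    have h1 : ∀ d : ℕ, ∀ᵐ x ∂μ, f^[d + 1] x ≠ x := by
      intro d
      have hm : MeasurableSet {x | f^[d + 1] x = x} := by
        have : {x | f^[d + 1] x = x} = {x | φ (f^[d + 1] x) = φ x} := by
          ext x; exact hinj.eq_iff.symm
        rw [this]
        exact measurableSet_eq_fun (hφ.comp (hf.iterate _)) hφ
      exact measure_eq_zero_iff_ae_notMem.1 (hap (d + 1) (Nat.succ_pos d) _ hm fun x hx => hx)
    have h2 : ∀ᵐ x ∂μ, ∀ i d : ℕ, f^[d + 1] (f^[i] x) ≠ f^[i] x :=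
      ae_all_iff.2 fun i => (hq.iterate i).ae (ae_all_iff.2 h1)
    filter_upwards [h2] with x hx
    refine Function.Injective.of_lt_imp_ne ?_
    intro i j hij h
    obtain ⟨d, rfl⟩ := Nat.exists_eq_add_of_lt hij
    apply hx i d
    rw [← Function.iterate_add_apply, show d + 1 + i = i + d + 1 by omega]
    exact h.symm
  tfae_finish
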